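/- arXiv:2510.23818 — 6 statements merged into one kernel-verified Lean document; each statement's English description precedes it below -/
import Mathlib

section
/- Let G ∈ ℝ^{m×n} have singular value decomposition G = U Σ Vᵀ (U ∈ ℝ^{m×m}, V ∈ ℝ^{n×n} orthogonal, Σ rectangular diagonal with singular values σ₁ ≥ σ₂ ≥ … ≥ 0), and suppose rank(G) ≥ 2r and the top singular values are strictly decreasing: σ₁ > σ₂ > … > σ_{2r} > σ_{2r+1}. Fix L > 0 and η > 0. Then a pair (A, B) with A ∈ ℝ^{m×r}, B ∈ ℝ^{n×r} globally minimizes the function F(A, B) := (L/2) ‖ (1/L) G − η G B Bᵀ − η A Aᵀ G ‖_F² if and only if there exist disjoint index sets 𝒜, ℬ ⊆ {1, …, 2r} with 𝒜 ∪ ℬ = {1, …, 2r}, |𝒜| = |ℬ| = r, and orthogonal matrices P, Q ∈ O(r) such that A = (1/√(Lη)) U_𝒜 P and B = (1/√(Lη)) V_ℬ Q, where U_𝒜 (resp. V_ℬ) denotes the submatrix of U (resp. V) formed by the columns indexed by 𝒜 (resp. ℬ). -/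
open Matrix

/-- Frobenius norm of a real matrix. -/
noncomputable def fnorm {m n : ℕ} (M : Matrix (Fin m) (Fin n) ℝ) : ℝ :=
  Real.sqrt (∑ i, ∑ j, (M i j) ^ 2)

/-- The objective F(A, B) := (L/2) ‖ (1/L) G − η G B Bᵀ − η A Aᵀ G ‖_F². -/
noncomputable def objF {m n r : ℕ} (L η : ℝ) (G : Matrix (Fin m) (Fin n) ℝ)
    (A : Matrix (Fin m) (Fin r) ℝ) (B : Matrix (Fin n) (Fin r) ℝ) : ℝ :=
  (L / 2) * (fnorm ((1 / L) • G - η • (G * B * Bᵀ) - η • (A * Aᵀ * G))) ^ 2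

theorem fnorm_sq {m n : ℕ} (M : Matrix (Fin m) (Fin n) ℝ) :
    fnorm M ^ 2 = ∑ i, ∑ j, M i j ^ 2 :=
  Real.sq_sqrt (Finset.sum_nonneg fun _ _ => Finset.sum_nonneg fun _ _ => sq_nonneg _)

theorem fnorm_sq_eq_trace {m n : ℕ} (M : Matrix (Fin m) (Fin n) ℝ) :
    fnorm M ^ 2 = (Mᵀ * M).trace := by
  rw [fnorm_sq, Finset.sum_comm]
  simp [Matrix.trace, Matrix.mul_apply, sq]

theorem fnorm_eq_zero {m n : ℕ} {M : Matrix (Fin m) (Fin n) ℝ} (h : fnorm M ^ 2 = 0) : M = 0 := by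
  rw [fnorm_sq_eq_trace, ← conjTranspose_eq_transpose_of_trivial] at h
  exact trace_conjTranspose_mul_self_eq_zero_iff.mp h

theorem fnorm_smul_sq {m n : ℕ} (c : ℝ) (M : Matrix (Fin m) (Fin n) ℝ) :
    fnorm (c • M) ^ 2 = c ^ 2 * fnorm M ^ 2 := by
  simp only [fnorm_sq_eq_trace, transpose_smul, smul_mul, Matrix.mul_smul, trace_smul, smul_eq_mul]
  ring

theorem fnorm_orthogonal_mul_mul_transpose_sq {m n : ℕ} {U : Matrix (Fin m) (Fin m) ℝ}
    {V : Matrix (Fin n) (Fin n) ℝ} (hU : Uᵀ * U = 1) (hV : Vᵀ * V = 1)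
    (M : Matrix (Fin m) (Fin n) ℝ) : fnorm (U * M * Vᵀ) ^ 2 = fnorm M ^ 2 := by
  simp only [fnorm_sq_eq_trace, transpose_mul, transpose_transpose]
  rw [trace_mul_comm]
  have : U * M * Vᵀ * (V * (Mᵀ * Uᵀ)) = U * (M * (Vᵀ * V) * Mᵀ) * Uᵀ := by
    simp only [Matrix.mul_assoc]
  rw [this, hV, Matrix.mul_one, trace_mul_comm, ← Matrix.mul_assoc, hU, Matrix.one_mul,
    trace_mul_comm]

/-- The orthogonal projection onto the column space of a matrix. -/
theorem exists_orthogonal_projection {m n : ℕ} (W : Matrix (Fin m) (Fin n) ℝ) :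
    ∃ E : Matrix (Fin m) (Fin m) ℝ, Eᵀ = E ∧ E * E = E ∧ E * W = W ∧ E.trace = W.rank := by
  let S : Submodule ℝ (EuclideanSpace ℝ (Fin m)) := LinearMap.range (Matrix.toEuclideanLin W)
  let b := stdOrthonormalBasis ℝ S
  let F : Matrix (Fin m) (Fin (Module.finrank ℝ S)) ℝ :=
    Matrix.of fun i k => (b k : EuclideanSpace ℝ (Fin m)) i
  have hF : Fᵀ * F = 1 := by
    ext k l
    have := orthonormal_iff_ite.mp b.orthonormal k l
    rw [Submodule.coe_inner, PiLp.inner_apply] at this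
    simp only [Matrix.mul_apply, transpose_apply, Matrix.one_apply, F, Matrix.of_apply]
    rw [← this]
    exact Finset.sum_congr rfl fun _ _ => mul_comm _ _
  have hS : Module.finrank ℝ S = W.rank := by
    rw [Matrix.rank_eq_finrank_range_toLin W (EuclideanSpace.basisFun _ ℝ).toBasis
      (EuclideanSpace.basisFun _ ℝ).toBasis]
    rfl
  refine ⟨F * Fᵀ, by simp, ?_, ?_, ?_⟩
  · rw [Matrix.mul_assoc, ← Matrix.mul_assoc Fᵀ, hF, Matrix.one_mul]
  · ext i j
    let w : S := ⟨Matrix.toEuclideanLin W (EuclideanSpace.single j 1), LinearMap.mem_range_self _ _⟩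
    have hw : ∀ i, (w : EuclideanSpace ℝ (Fin m)) i = W i j := by
      intro i
      simp [w, Matrix.toLpLin_apply]
    have h := congrArg (fun z : S => (z : EuclideanSpace ℝ (Fin m)) i) (b.sum_repr' w)
    simp only [hw] at h
    have hcoef : ∀ k, inner ℝ (b k) w = (Fᵀ * W) k j := by
      intro k
      rw [Submodule.coe_inner, PiLp.inner_apply, Matrix.mul_apply]
      refine Finset.sum_congr rfl fun l _ => ?_
      rw [hw]
      exact mul_comm _ _
    rw [← h, Matrix.mul_assoc, Matrix.mul_apply]
    simp only [hcoef, Submodule.coe_sum, Submodule.coe_smul, WithLp.ofLp_sum, Finset.sum_apply,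
      PiLp.smul_apply, smul_eq_mul]
    exact Finset.sum_congr rfl fun k _ => mul_comm _ _
  · rw [trace_mul_comm, hF, ← hS]
    simp

theorem sum_sq_row_eq_diag {m : ℕ} {E : Matrix (Fin m) (Fin m) ℝ} (hs : Eᵀ = E)
    (hi : E * E = E) (i : Fin m) : ∑ j, E i j ^ 2 = E i i := by
  conv_rhs => rw [← hi, Matrix.mul_apply]
  refine Finset.sum_congr rfl fun j _ => ?_
  rw [sq]
  congr 1
  conv_lhs => rw [← hs]
  rfl

theorem sq_le_diag {m : ℕ} {E : Matrix (Fin m) (Fin m) ℝ} (hs : Eᵀ = E)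
    (hi : E * E = E) (i j : Fin m) : E i j ^ 2 ≤ E i i := by
  rw [← sum_sq_row_eq_diag hs hi i]
  exact Finset.single_le_sum (f := fun j => E i j ^ 2) (fun _ _ => sq_nonneg _) (Finset.mem_univ j)

/-- A symmetric idempotent matrix whose diagonal entries are `0` or `1` is diagonal. -/
theorem eq_diagonal_of_diag_zero_or_one {m : ℕ} {E : Matrix (Fin m) (Fin m) ℝ} (hs : Eᵀ = E)
    (hi : E * E = E) (h : ∀ i, E i i = 0 ∨ E i i = 1) : E = diagonal fun i => E i i := by
  ext i j
  rcases eq_or_ne i j with rfl | hij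
  · simp
  rw [diagonal_apply_ne _ hij]
  have hsum := sum_sq_row_eq_diag hs hi i
  have h2 : E i i ^ 2 + E i j ^ 2 ≤ E i i := by
    refine le_trans ?_ hsum.le
    rw [← Finset.sum_pair (f := fun j => E i j ^ 2) hij]
    exact Finset.sum_le_sum_of_subset_of_nonneg (Finset.subset_univ _) fun _ _ _ => sq_nonneg _
  rcases h i with h | h <;> rw [h] at h2 <;> nlinarith [sq_nonneg (E i j)]

/-- The rectangular diagonal matrix with diagonal entries `σ 0, σ 1, …`. -/
def rectDiag (m n : ℕ) (σ : ℕ → ℝ) : Matrix (Fin m) (Fin n) ℝ :=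
  Matrix.of fun i j => if (i : ℕ) = (j : ℕ) then σ (i : ℕ) else 0

/-- The diagonal projection onto the first `k` coordinates. -/
def initProj (m k : ℕ) : Matrix (Fin m) (Fin m) ℝ :=
  diagonal fun i => if (i : ℕ) < k then 1 else 0

theorem trace_initProj {m k : ℕ} (hk : k ≤ m) : (initProj m k).trace = k := by
  simp only [initProj, trace_diagonal, Finset.sum_boole]
  rw [Fin.card_filter_val_lt, min_eq_right hk]

theorem fnorm_sub_proj_mul_sq {m n : ℕ} (σ : ℕ → ℝ) {E : Matrix (Fin m) (Fin m) ℝ} (hs : Eᵀ = E)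
    (hi : E * E = E) :
    fnorm (rectDiag m n σ - E * rectDiag m n σ) ^ 2 =
      ∑ i : Fin m, (if (i : ℕ) < n then σ i ^ 2 else 0) * (1 - E i i) := by
  have h1 : (rectDiag m n σ - E * rectDiag m n σ)ᵀ * (rectDiag m n σ - E * rectDiag m n σ) =
      (rectDiag m n σ)ᵀ * ((1 - E) * rectDiag m n σ) := by
    have h2 : rectDiag m n σ - E * rectDiag m n σ = (1 - E) * rectDiag m n σ := by
      rw [Matrix.sub_mul, Matrix.one_mul]
    have h3 : (1 - E) * (1 - E) = 1 - E := by
      simp [Matrix.sub_mul, Matrix.mul_sub, hi]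
    rw [h2, transpose_mul, transpose_sub, hs, transpose_one, Matrix.mul_assoc,
      ← Matrix.mul_assoc (1 - E), h3]
  have h4 : rectDiag m n σ * (rectDiag m n σ)ᵀ =
      diagonal fun i : Fin m => if (i : ℕ) < n then σ i ^ 2 else 0 := by
    ext i j
    simp only [rectDiag, Matrix.mul_apply, transpose_apply, Matrix.of_apply, diagonal_apply]
    by_cases hin : (i : ℕ) < n
    · rw [Finset.sum_eq_single ⟨i, hin⟩]
      · by_cases hij : i = j
        · subst hij; simp [hin, sq]
        · have : (j : ℕ) ≠ i := fun h => hij (Fin.ext h.symm)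
          simp [hij, this]
      · intro k _ hk
        have : (i : ℕ) ≠ k := fun h => hk (Fin.ext h.symm)
        simp [this]
      · simp
    · rw [Finset.sum_eq_zero]
      · simp [hin]
      · intro k _
        have : (i : ℕ) ≠ k := by have := k.2; omega
        simp [this]
  rw [fnorm_sq_eq_trace, h1, trace_mul_comm, Matrix.mul_assoc, h4, trace_mul_comm]
  simp [Matrix.trace, diagonal_mul]

/-- The Eckart-Young theorem in the Frobenius norm for a rectangular diagonal matrix, with
uniqueness of the best approximation under a spectral gap. -/
theorem eckart_young {m n k : ℕ} {σ : ℕ → ℝ} (hσ0 : ∀ i, 0 ≤ σ i)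
    (hσmono : ∀ i j, i ≤ j → σ j ≤ σ i) (hm : k ≤ m) (hn : k ≤ n)
    (hgap : ∀ i < k, σ k < σ i) (W : Matrix (Fin m) (Fin n) ℝ) (hW : W.rank ≤ k) :
    fnorm (rectDiag m n σ - initProj m k * rectDiag m n σ) ^ 2 ≤ fnorm (rectDiag m n σ - W) ^ 2 ∧
    (fnorm (rectDiag m n σ - W) ^ 2 ≤
        fnorm (rectDiag m n σ - initProj m k * rectDiag m n σ) ^ 2 →
      W = initProj m k * rectDiag m n σ) := by
  obtain ⟨E, hs, hi, hEW, htr⟩ := exists_orthogonal_projection W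
  have hpyth : fnorm (rectDiag m n σ - W) ^ 2 =
      fnorm (rectDiag m n σ - E * rectDiag m n σ) ^ 2 + fnorm (E * rectDiag m n σ - W) ^ 2 := by
    set S := rectDiag m n σ
    have hb : E * S - W = E * (S - W) := by rw [Matrix.mul_sub, hEW]
    have hcross : (S - E * S)ᵀ * (E * S - W) = 0 := by
      rw [hb, transpose_sub, transpose_mul, hs, ← Matrix.mul_assoc, Matrix.sub_mul,
        Matrix.mul_assoc, hi, sub_self, Matrix.zero_mul]
    have hcross' : (E * S - W)ᵀ * (S - E * S) = 0 := by
      rw [← transpose_transpose ((E * S - W)ᵀ * (S - E * S)), transpose_mul, transpose_transpose,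
        hcross, transpose_zero]
    have hsum : S - W = (S - E * S) + (E * S - W) := by abel
    rw [fnorm_sq_eq_trace, fnorm_sq_eq_trace, fnorm_sq_eq_trace, ← trace_add]
    congr 1
    rw [hsum, transpose_add, Matrix.add_mul, Matrix.mul_add, Matrix.mul_add, hcross, hcross',
      add_zero, zero_add]
  have hDs : (initProj m k)ᵀ = initProj m k := by simp [initProj]
  have hDi : initProj m k * initProj m k = initProj m k := by
    simp [initProj]
  set s : Fin m → ℝ := fun i => if (i : ℕ) < n then σ i ^ 2 else 0 with hsdef
  set d : Fin m → ℝ := fun i => if (i : ℕ) < k then 1 else 0 with hddef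
  have hDd : ∀ i, initProj m k i i = d i := fun i => by simp [initProj, hddef]
  have hdsum : ∑ i, d i = k := by
    rw [← trace_initProj hm]; simp [Matrix.trace, hDd]
  have htr' : ∑ i, E i i ≤ k := by
    have h : E.trace ≤ k := by rw [htr]; exact_mod_cast hW
    simpa [Matrix.trace] using h
  have hp0 : ∀ i, 0 ≤ E i i := fun i => (sq_nonneg _).trans (sq_le_diag hs hi i i)
  have hp1 : ∀ i, E i i ≤ 1 := fun i => by nlinarith [sq_le_diag hs hi i i, hp0 i]
  have hterm : ∀ i, 0 ≤ (s i - σ k ^ 2) * (d i - E i i) := by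
    intro i
    by_cases hik : (i : ℕ) < k
    · have : (i : ℕ) < n := by omega
      simp only [hsdef, hddef, hik, this, if_true]
      have := hgap i hik
      exact mul_nonneg (by nlinarith [hσ0 k]) (by linarith [hp1 i])
    · have h1 : s i ≤ σ k ^ 2 := by
        simp only [hsdef]
        split_ifs
        · exact pow_le_pow_left₀ (hσ0 _) (hσmono _ _ (by omega)) 2
        · positivity
      simp only [hddef, hik, if_false]
      nlinarith [hp0 i]
  have hdiff : ∑ i, s i * (1 - E i i) - ∑ i, s i * (1 - d i) =
      ∑ i, (s i - σ k ^ 2) * (d i - E i i) + σ k ^ 2 * (k - ∑ i, E i i) := by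
    rw [← hdsum, ← Finset.sum_sub_distrib, ← Finset.sum_sub_distrib, Finset.mul_sum,
      ← Finset.sum_add_distrib]
    exact Finset.sum_congr rfl fun i _ => by ring
  have hnn : 0 ≤ ∑ i, (s i - σ k ^ 2) * (d i - E i i) := Finset.sum_nonneg fun i _ => hterm i
  have hnn' : 0 ≤ σ k ^ 2 * (k - ∑ i, E i i) := mul_nonneg (sq_nonneg _) (by linarith)
  rw [hpyth, fnorm_sub_proj_mul_sq σ hs hi, fnorm_sub_proj_mul_sq σ hDs hDi]
  simp only [hDd]
  have hres : 0 ≤ fnorm (E * rectDiag m n σ - W) ^ 2 := sq_nonneg _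
  refine ⟨by linarith, fun hle => ?_⟩
  have hz : ∑ i, (s i - σ k ^ 2) * (d i - E i i) = 0 := by linarith
  have hW0 := fnorm_eq_zero (M := E * rectDiag m n σ - W) (by linarith)
  rw [Finset.sum_eq_zero_iff_of_nonneg fun i _ => hterm i] at hz
  have hlt : ∀ i : Fin m, (i : ℕ) < k → E i i = 1 := by
    intro i hik
    have h := hz i (Finset.mem_univ i)
    have : (i : ℕ) < n := by omega
    simp only [hsdef, hddef, hik, this, if_true] at h
    have := hgap i hik
    rcases mul_eq_zero.mp h with h | h
    · nlinarith [hσ0 k]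
    · linarith
  have hge : ∀ i, 0 ≤ E i i - d i := by
    intro i
    by_cases hik : (i : ℕ) < k
    · simp [hddef, hik, hlt i hik]
    · simp [hddef, hik, hp0 i]
  have hsum0 : ∑ i, (E i i - d i) = 0 :=
    le_antisymm (by rw [Finset.sum_sub_distrib]; linarith) (Finset.sum_nonneg fun i _ => hge i)
  rw [Finset.sum_eq_zero_iff_of_nonneg fun i _ => hge i] at hsum0
  have hdiag : ∀ i, E i i = d i := fun i => sub_eq_zero.mp (hsum0 i (Finset.mem_univ i))
  have hE : E = initProj m k := by
    rw [eq_diagonal_of_diag_zero_or_one hs hi fun i => ?_]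
    · simp only [hdiag]; rfl
    · rw [hdiag]; simp only [hddef]; split_ifs <;> simp
  rw [← hE]
  exact (sub_eq_zero.mp hW0).symm

/-- If the Gram matrix of the rows of `X` agrees with the identity on `r` columns, then `X` is, up
to a right orthogonal factor, the corresponding column selection matrix. -/
theorem exists_orthogonal_factor {m r : ℕ} (X : Matrix (Fin m) (Fin r) ℝ) (s : Finset (Fin m))
    (hs : s.card = r) (h : ∀ i, ∀ j ∈ s, (X * Xᵀ) i j = (1 : Matrix (Fin m) (Fin m) ℝ) i j) :
    ∃ P : Matrix (Fin r) (Fin r) ℝ, Pᵀ * P = 1 ∧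
      X = (1 : Matrix (Fin m) (Fin m) ℝ).submatrix id (fun k => (s.orderIsoOfFin hs k : Fin m)) *
        P := by
  set f : Fin r → Fin m := fun k => (s.orderIsoOfFin hs k : Fin m)
  have hfinj : Function.Injective f :=
    Subtype.val_injective.comp (s.orderIsoOfFin hs).injective
  have hXP : X * (X.submatrix f id)ᵀ = (1 : Matrix (Fin m) (Fin m) ℝ).submatrix id f := by
    ext i k
    exact h i (f k) (s.orderIsoOfFin hs k).2
  have hPP : (X.submatrix f id) * (X.submatrix f id)ᵀ = 1 := by
    ext k l
    have := h (f k) (f l) (s.orderIsoOfFin hs l).2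
    rw [Matrix.one_apply] at this
    simp only [hfinj.eq_iff] at this
    rw [Matrix.one_apply, ← this]
    rfl
  have hPP' := mul_eq_one_comm.mp hPP
  exact ⟨X.submatrix f id, hPP', by rw [← hXP, Matrix.mul_assoc, hPP', Matrix.mul_one]⟩

/-- Nonzero pairwise orthogonal rows of length `r` number at most `r`. -/
theorem card_filter_ne_zero_le_of_mul_transpose_eq_diagonal {k r : ℕ}
    (X : Matrix (Fin k) (Fin r) ℝ) (d : Fin k → ℝ) (h : X * Xᵀ = diagonal d) :
    (Finset.univ.filter fun i => d i ≠ 0).card ≤ r := by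
  have h1 : (diagonal d).rank ≤ r := by
    rw [← h]
    refine (Matrix.rank_mul_le_left _ _).trans ((Matrix.rank_le_card_width X).trans (by simp))
  rw [Matrix.rank_diagonal, Fintype.card_subtype] at h1
  exact h1

theorem row_eq_zero_of_mul_transpose_diag_eq_zero {m r : ℕ} {X : Matrix (Fin m) (Fin r) ℝ}
    {i : Fin m} (h : (X * Xᵀ) i i = 0) (l : Fin r) : X i l = 0 := by
  simp only [Matrix.mul_apply, transpose_apply] at h
  rw [Finset.sum_eq_zero_iff_of_nonneg fun _ _ => mul_self_nonneg _] at h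
  simpa using h l (Finset.mem_univ l)

theorem mul_transpose_apply_eq_zero_left {m r : ℕ} {X : Matrix (Fin m) (Fin r) ℝ}
    {i : Fin m} (h : (X * Xᵀ) i i = 0) (j : Fin m) : (X * Xᵀ) i j = 0 := by
  rw [Matrix.mul_apply]
  exact Finset.sum_eq_zero fun l _ => by
    rw [row_eq_zero_of_mul_transpose_diag_eq_zero h l, zero_mul]

theorem mul_transpose_apply_comm {m r : ℕ} (X : Matrix (Fin m) (Fin r) ℝ) (i j : Fin m) :
    (X * Xᵀ) i j = (X * Xᵀ) j i := by
  simp [Matrix.mul_apply, mul_comm]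

theorem mul_rectDiag_apply {m n : ℕ} (σ : ℕ → ℝ) (M : Matrix (Fin m) (Fin m) ℝ) (i j : Fin m)
    (j' : Fin n) (h : (j : ℕ) = j') : (M * rectDiag m n σ) i j' = M i j * σ j := by
  rw [Matrix.mul_apply, Finset.sum_eq_single j]
  · simp [rectDiag, h]
  · intro k _ hk
    have : (k : ℕ) ≠ j' := fun h' => hk (Fin.ext (h'.trans h.symm))
    simp [rectDiag, this]
  · simp

theorem rectDiag_mul_apply {m n : ℕ} (σ : ℕ → ℝ) (M : Matrix (Fin n) (Fin n) ℝ) (i : Fin m)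
    (i' j : Fin n) (h : (i : ℕ) = i') : (rectDiag m n σ * M) i j = σ i * M i' j := by
  rw [Matrix.mul_apply, Finset.sum_eq_single i']
  · simp [rectDiag, h]
  · intro k _ hk
    have : (i : ℕ) ≠ k := fun h' => hk (Fin.ext (h'.symm.trans h))
    simp [rectDiag, this]
  · simp

theorem initProj_mul_rectDiag_apply {m n k : ℕ} (σ : ℕ → ℝ) (i : Fin m) (j : Fin n) :
    (initProj m k * rectDiag m n σ) i j = if (i : ℕ) < k ∧ (i : ℕ) = j then σ i else 0 := by
  simp only [initProj, rectDiag, diagonal_mul, Matrix.of_apply, ite_mul, one_mul, zero_mul, ite_and]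

/-- Solutions of `X Xᵀ S + S Y Yᵀ = S_{2r}` for a rectangular diagonal `S` whose first `2r`
diagonal entries are positive and distinct. -/
theorem exists_selection_of_eq {m n r : ℕ} {σ : ℕ → ℝ} (hm : 2 * r ≤ m) (hn : 2 * r ≤ n)
    (hpos : ∀ k < 2 * r, 0 < σ k)
    (hinj : ∀ k < 2 * r, ∀ l < 2 * r, σ k = σ l → k = l)
    (X : Matrix (Fin m) (Fin r) ℝ) (Y : Matrix (Fin n) (Fin r) ℝ)
    (h : X * Xᵀ * rectDiag m n σ + rectDiag m n σ * (Y * Yᵀ) =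
      initProj m (2 * r) * rectDiag m n σ) :
    ∃ (s : Finset (Fin m)) (t : Finset (Fin n)), s.card = r ∧ t.card = r ∧
      Disjoint (s.image Fin.val) (t.image Fin.val) ∧
      s.image Fin.val ∪ t.image Fin.val = Finset.range (2 * r) ∧
      (∀ i, ∀ j ∈ s, (X * Xᵀ) i j = (1 : Matrix (Fin m) (Fin m) ℝ) i j) ∧
      (∀ i, ∀ j ∈ t, (Y * Yᵀ) i j = (1 : Matrix (Fin n) (Fin n) ℝ) i j) := by
  let a : Fin (2 * r) → Fin m := Fin.castLE hm
  let b : Fin (2 * r) → Fin n := Fin.castLE hn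
  have ha : Function.Injective a := Fin.castLE_injective hm
  have hb : Function.Injective b := Fin.castLE_injective hn
  have hent : ∀ k l, (X * Xᵀ) (a k) (a l) * σ l + σ k * (Y * Yᵀ) (b k) (b l) =
      if k = l then σ k else 0 := by
    intro k l
    have h1 := congrFun (congrFun h (a k)) (b l)
    rw [Matrix.add_apply, mul_rectDiag_apply σ (X * Xᵀ) (a k) (a l) (b l) rfl,
      rectDiag_mul_apply σ (Y * Yᵀ) (a k) (b k) (b l) rfl, initProj_mul_rectDiag_apply] at h1
    simpa [a, b, Fin.ext_iff] using h1
  have hoff : ∀ k l, k ≠ l → (X * Xᵀ) (a k) (a l) = 0 ∧ (Y * Yᵀ) (b k) (b l) = 0 := by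
    intro k l hkl
    have e1 := hent k l
    have e2 := hent l k
    rw [mul_transpose_apply_comm X, mul_transpose_apply_comm Y] at e2
    rw [if_neg hkl] at e1
    rw [if_neg hkl.symm] at e2
    have hk := hpos k k.2
    have hl := hpos l l.2
    have hne : σ k - σ l ≠ 0 := fun h0 =>
      hkl (Fin.ext (hinj k k.2 l l.2 (sub_eq_zero.mp h0)))
    have hx : (X * Xᵀ) (a k) (a l) * ((σ k - σ l) * (σ k + σ l)) = 0 := by
      linear_combination σ k * e2 - σ l * e1
    have hx0 : (X * Xᵀ) (a k) (a l) = 0 := by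
      rcases mul_eq_zero.mp hx with h | h
      · exact h
      · exact absurd h (mul_ne_zero hne (by positivity))
    refine ⟨hx0, ?_⟩
    rw [hx0, zero_mul, zero_add] at e1
    exact (mul_eq_zero.mp e1).resolve_left hk.ne'
  have hdiag : ∀ k, (X * Xᵀ) (a k) (a k) + (Y * Yᵀ) (b k) (b k) = 1 := by
    intro k
    have e := hent k k
    rw [if_pos rfl] at e
    have hk := hpos k k.2
    exact mul_right_cancel₀ hk.ne' (by linear_combination e)
  set p : Fin (2 * r) → ℝ := fun k => (X * Xᵀ) (a k) (a k)
  set q : Fin (2 * r) → ℝ := fun k => (Y * Yᵀ) (b k) (b k)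
  have hI : (Finset.univ.filter fun k => p k ≠ 0).card ≤ r := by
    refine card_filter_ne_zero_le_of_mul_transpose_eq_diagonal (X.submatrix a id) p ?_
    ext k l
    rcases eq_or_ne k l with rfl | hkl
    · rw [diagonal_apply_eq]; rfl
    · rw [diagonal_apply_ne _ hkl]; exact (hoff k l hkl).1
  have hJ : (Finset.univ.filter fun k => q k ≠ 0).card ≤ r := by
    refine card_filter_ne_zero_le_of_mul_transpose_eq_diagonal (Y.submatrix b id) q ?_
    ext k l
    rcases eq_or_ne k l with rfl | hkl
    · rw [diagonal_apply_eq]; rfl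
    · rw [diagonal_apply_ne _ hkl]; exact (hoff k l hkl).2
  set I := Finset.univ.filter fun k => p k ≠ 0 with hIdef
  set J := Finset.univ.filter fun k => q k ≠ 0 with hJdef
  have hU : I ∪ J = Finset.univ := by
    ext k
    simp only [hIdef, hJdef, Finset.mem_union, Finset.mem_filter, Finset.mem_univ, true_and,
      iff_true]
    by_contra! hc
    linarith [hdiag k, hc.1, hc.2]
  have hcard := Finset.card_union_add_card_inter I J
  rw [hU, Finset.card_univ, Fintype.card_fin] at hcard
  have hIJ : Disjoint I J := by
    rw [Finset.disjoint_iff_inter_eq_empty, ← Finset.card_eq_zero]; omega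
  have hIc : I.card = r := by omega
  have hJc : J.card = r := by omega
  have hqI : ∀ k ∈ I, q k = 0 := by
    intro k hk
    by_contra hne
    exact Finset.disjoint_left.mp hIJ hk (by simp [hJdef, hne])
  have hpJ : ∀ k ∈ J, p k = 0 := by
    intro k hk
    by_contra hne
    exact Finset.disjoint_left.mp hIJ (by simp [hIdef, hne]) hk
  have himg : (I.image a).image Fin.val = I.image Fin.val := by
    rw [Finset.image_image]; rfl
  have himg' : (J.image b).image Fin.val = J.image Fin.val := by
    rw [Finset.image_image]; rfl
  refine ⟨I.image a, J.image b, ?_, ?_, ?_, ?_, ?_, ?_⟩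
  · rw [Finset.card_image_of_injective _ ha, hIc]
  · rw [Finset.card_image_of_injective _ hb, hJc]
  · rw [himg, himg', Finset.disjoint_image Fin.val_injective]
    exact hIJ
  · rw [himg, himg', ← Finset.image_union, hU]
    ext x
    simp only [Finset.mem_image, Finset.mem_univ, true_and, Finset.mem_range]
    exact ⟨fun ⟨k, hk⟩ => hk ▸ k.2, fun hx => ⟨⟨x, hx⟩, rfl⟩⟩
  · intro i j hj
    obtain ⟨l, hl, rfl⟩ := Finset.mem_image.mp hj
    have hql := hqI l hl
    by_cases hi : (i : ℕ) < 2 * r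
    · obtain ⟨k, rfl⟩ : ∃ k, i = a k := ⟨⟨i, hi⟩, rfl⟩
      rcases eq_or_ne k l with rfl | hne
      · rw [Matrix.one_apply_eq]
        linarith [hdiag k]
      · rw [Matrix.one_apply_ne (ha.ne hne)]
        exact (hoff _ l hne).1
    · have hne : i ≠ a l := fun h' => hi (by rw [h']; exact l.2)
      have h1 := congrFun (congrFun h i) (b l)
      have h0 : (rectDiag m n σ * (Y * Yᵀ)) i (b l) = 0 := by
        rw [Matrix.mul_apply]
        exact Finset.sum_eq_zero fun k _ => by
          rw [mul_transpose_apply_comm, mul_transpose_apply_eq_zero_left hql, mul_zero]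
      rw [Matrix.add_apply, mul_rectDiag_apply σ (X * Xᵀ) i (a l) (b l) rfl, h0,
        initProj_mul_rectDiag_apply, if_neg (fun hc => hi hc.1), add_zero] at h1
      rw [Matrix.one_apply_ne hne]
      exact (mul_eq_zero.mp h1).resolve_right (hpos l l.2).ne'
  · intro i j hj
    obtain ⟨l, hl, rfl⟩ := Finset.mem_image.mp hj
    have hpl := hpJ l hl
    by_cases hi : (i : ℕ) < 2 * r
    · obtain ⟨k, rfl⟩ : ∃ k, i = b k := ⟨⟨i, hi⟩, rfl⟩
      rcases eq_or_ne k l with rfl | hne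
      · rw [Matrix.one_apply_eq]
        linarith [hdiag k]
      · rw [Matrix.one_apply_ne (hb.ne hne)]
        exact (hoff _ l hne).2
    · have hne : i ≠ b l := fun h' => hi (by rw [h']; exact l.2)
      have h1 := congrFun (congrFun h (a l)) i
      have h0 : (X * Xᵀ * rectDiag m n σ) (a l) i = 0 := by
        rw [Matrix.mul_apply]
        exact Finset.sum_eq_zero fun k _ => by
          rw [mul_transpose_apply_eq_zero_left hpl, zero_mul]
      have hval : ((a l : Fin m) : ℕ) ≠ i := fun h' => hi (by rw [← h']; exact l.2)
      rw [Matrix.add_apply, rectDiag_mul_apply σ (Y * Yᵀ) (a l) (b l) i rfl, h0,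
        initProj_mul_rectDiag_apply, if_neg (fun hc => hval hc.2), zero_add] at h1
      rw [Matrix.one_apply_ne hne, mul_transpose_apply_comm]
      exact (mul_eq_zero.mp h1).resolve_left (hpos l l.2).ne'

theorem selection_mul_transpose {m r : ℕ} (s : Finset (Fin m)) (hs : s.card = r)
    (P : Matrix (Fin r) (Fin r) ℝ) (hP : Pᵀ * P = 1) :
    ((1 : Matrix (Fin m) (Fin m) ℝ).submatrix id (fun k => (s.orderIsoOfFin hs k : Fin m)) * P) *
      ((1 : Matrix (Fin m) (Fin m) ℝ).submatrix id (fun k => (s.orderIsoOfFin hs k : Fin m)) *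
        P)ᵀ = diagonal fun i => if i ∈ s then 1 else 0 := by
  rw [transpose_mul, Matrix.mul_assoc, ← Matrix.mul_assoc P, mul_eq_one_comm.mp hP, Matrix.one_mul]
  ext i j
  have hsum := (s.orderIsoOfFin hs).toEquiv.sum_comp fun x : s =>
    (1 : Matrix (Fin m) (Fin m) ℝ) i x * (1 : Matrix (Fin m) (Fin m) ℝ) j x
  rw [Finset.sum_coe_sort s fun x =>
    (1 : Matrix (Fin m) (Fin m) ℝ) i x * (1 : Matrix (Fin m) (Fin m) ℝ) j x] at hsum
  refine hsum.trans ?_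
  simp only [Matrix.one_apply, diagonal_apply]
  by_cases hij : i = j
  · subst hij; simp
  · simp only [hij, if_false]
    exact Finset.sum_eq_zero fun x _ => by
      by_cases h1 : i = x
      · subst h1; simp [Ne.symm hij]
      · simp [h1]

theorem diagonal_mul_rectDiag_add {m n k : ℕ} (σ : ℕ → ℝ) (s : Finset (Fin m)) (t : Finset (Fin n))
    (hd : Disjoint (s.image Fin.val) (t.image Fin.val))
    (hu : s.image Fin.val ∪ t.image Fin.val = Finset.range k) :
    (diagonal fun i => if i ∈ s then (1 : ℝ) else 0) * rectDiag m n σ +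
      rectDiag m n σ * (diagonal fun j => if j ∈ t then (1 : ℝ) else 0) =
      initProj m k * rectDiag m n σ := by
  ext i j
  rw [initProj_mul_rectDiag_apply, Matrix.add_apply, diagonal_mul, mul_diagonal]
  simp only [rectDiag, Matrix.of_apply]
  by_cases hij : (i : ℕ) = j
  · have h1 : i ∈ s ↔ (i : ℕ) ∈ s.image Fin.val :=
      (Fin.val_injective.mem_finset_image).symm
    have h2 : j ∈ t ↔ (i : ℕ) ∈ t.image Fin.val := by
      rw [hij, Fin.val_injective.mem_finset_image]
    have h3 : (i : ℕ) < k ↔ (i : ℕ) ∈ s.image Fin.val ∪ t.image Fin.val := by rw [hu]; simp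
    have h4 : (i : ℕ) ∈ s.image Fin.val → (i : ℕ) ∉ t.image Fin.val :=
      fun h => Finset.disjoint_left.mp hd h
    rw [Finset.mem_union] at h3
    simp only [h1, h2, h3, if_pos hij, and_iff_left hij]
    by_cases hs : (i : ℕ) ∈ s.image Fin.val <;> by_cases ht : (i : ℕ) ∈ t.image Fin.val
    · exact absurd ht (h4 hs)
    · rw [if_pos hs, if_neg ht, if_pos (Or.inl hs), one_mul, mul_zero, add_zero]
    · rw [if_neg hs, if_pos ht, if_pos (Or.inr ht), zero_mul, mul_one, zero_add]
    · rw [if_neg hs, if_neg ht, if_neg (not_or.mpr ⟨hs, ht⟩), zero_mul, mul_zero, add_zero]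
  · simp [hij]

/-- The objective in the coordinates given by the singular vectors. -/
theorem objF_eq {m n r : ℕ} {L η : ℝ} (hL : 0 < L) (hη : 0 < η)
    {U : Matrix (Fin m) (Fin m) ℝ} {V : Matrix (Fin n) (Fin n) ℝ} (hU : Uᵀ * U = 1)
    (hV : Vᵀ * V = 1) (S : Matrix (Fin m) (Fin n) ℝ)
    (X : Matrix (Fin m) (Fin r) ℝ) (Y : Matrix (Fin n) (Fin r) ℝ) :
    objF L η (U * S * Vᵀ) ((1 / Real.sqrt (L * η)) • (U * X)) ((1 / Real.sqrt (L * η)) • (V * Y)) =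
      1 / (2 * L) * fnorm (S - (X * Xᵀ * S + S * (Y * Yᵀ))) ^ 2 := by
  have hsq : Real.sqrt (L * η) * Real.sqrt (L * η) = L * η :=
    Real.mul_self_sqrt (by positivity)
  have hc : η * (1 / Real.sqrt (L * η) * (1 / Real.sqrt (L * η))) = 1 / L := by
    rw [div_mul_div_comm, hsq]
    field_simp
  have h1 : U * S * Vᵀ * (V * Y) = U * (S * Y) := by
    rw [Matrix.mul_assoc, ← Matrix.mul_assoc Vᵀ, hV, Matrix.one_mul, Matrix.mul_assoc]
  have h2 : (U * X)ᵀ * (U * S * Vᵀ) = Xᵀ * S * Vᵀ := by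
    rw [transpose_mul, Matrix.mul_assoc U, Matrix.mul_assoc, ← Matrix.mul_assoc Uᵀ, hU,
      Matrix.one_mul, ← Matrix.mul_assoc]
  have h3 : (1 / L) • (U * S * Vᵀ) -
      η • (U * S * Vᵀ * ((1 / Real.sqrt (L * η)) • (V * Y)) *
        ((1 / Real.sqrt (L * η)) • (V * Y))ᵀ) -
      η • ((1 / Real.sqrt (L * η)) • (U * X) * ((1 / Real.sqrt (L * η)) • (U * X))ᵀ *
        (U * S * Vᵀ)) = (1 / L) • (U * (S - (X * Xᵀ * S + S * (Y * Yᵀ))) * Vᵀ) := by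
    simp only [transpose_smul, smul_mul, Matrix.mul_smul, smul_smul, hc]
    rw [h1, Matrix.mul_assoc (U * X), h2, ← smul_sub, ← smul_sub]
    congr 1
    simp only [Matrix.mul_sub, Matrix.sub_mul, Matrix.mul_add, Matrix.add_mul, transpose_mul,
      Matrix.mul_assoc]
    abel
  rw [objF, h3, fnorm_smul_sq, fnorm_orthogonal_mul_mul_transpose_sq hU hV]
  field_simp

theorem rank_mul_transpose_mul_add_le {m n r : ℕ} (S : Matrix (Fin m) (Fin n) ℝ)
    (X : Matrix (Fin m) (Fin r) ℝ) (Y : Matrix (Fin n) (Fin r) ℝ) :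
    (X * Xᵀ * S + S * (Y * Yᵀ)).rank ≤ 2 * r := by
  have h : X * Xᵀ * S + S * (Y * Yᵀ) = fromCols X (S * Y) * fromRows (Xᵀ * S) Yᵀ := by
    rw [fromCols_mul_fromRows, Matrix.mul_assoc, Matrix.mul_assoc]
  rw [h]
  refine (Matrix.rank_mul_le_left _ _).trans ((Matrix.rank_le_card_width _).trans ?_)
  simp [two_mul]

theorem smul_orthogonal_mul_cancel {m r : ℕ} {c : ℝ} (hc : c ≠ 0) {U : Matrix (Fin m) (Fin m) ℝ}
    (hU : Uᵀ * U = 1) (A : Matrix (Fin m) (Fin r) ℝ) :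
    (1 / c) • (U * (c • (Uᵀ * A))) = A := by
  rw [Matrix.mul_smul, smul_smul, one_div_mul_cancel hc, one_smul, ← Matrix.mul_assoc,
    mul_eq_one_comm.mp hU, Matrix.one_mul]

theorem submatrix_mul_eq {m r : ℕ} (U : Matrix (Fin m) (Fin m) ℝ) (f : Fin r → Fin m)
    (P : Matrix (Fin r) (Fin r) ℝ) :
    U.submatrix id f * P = U * ((1 : Matrix (Fin m) (Fin m) ℝ).submatrix id f * P) := by
  rw [← Matrix.mul_assoc]
  congr 1
  ext i k
  simp [Matrix.mul_apply, Matrix.one_apply]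

theorem stmt0 {m n r : ℕ} (L η : ℝ) (hL : 0 < L) (hη : 0 < η)
    (G : Matrix (Fin m) (Fin n) ℝ)
    (U : Matrix (Fin m) (Fin m) ℝ) (V : Matrix (Fin n) (Fin n) ℝ) (σ : ℕ → ℝ)
    (hU : Uᵀ * U = 1) (hV : Vᵀ * V = 1)
    (hG : G = U * (Matrix.of fun (i : Fin m) (j : Fin n) =>
        if (i : ℕ) = (j : ℕ) then σ (i : ℕ) else 0) * Vᵀ)
    (hσ0 : ∀ k, 0 ≤ σ k) (hσmono : ∀ k l, k ≤ l → σ l ≤ σ k)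
    (hrank : 2 * r ≤ G.rank)
    (hstrict : ∀ k < 2 * r, σ (k + 1) < σ k)
    (A : Matrix (Fin m) (Fin r) ℝ) (B : Matrix (Fin n) (Fin r) ℝ) :
    (∀ (A' : Matrix (Fin m) (Fin r) ℝ) (B' : Matrix (Fin n) (Fin r) ℝ),
        objF L η G A B ≤ objF L η G A' B') ↔
      (∃ (𝒜 : Finset (Fin m)) (ℬ : Finset (Fin n)) (h𝒜 : 𝒜.card = r) (hℬ : ℬ.card = r),
        Disjoint (𝒜.image Fin.val) (ℬ.image Fin.val) ∧
        𝒜.image Fin.val ∪ ℬ.image Fin.val = Finset.range (2 * r) ∧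
        ∃ P Q : Matrix (Fin r) (Fin r) ℝ, Pᵀ * P = 1 ∧ Qᵀ * Q = 1 ∧
          A = (1 / Real.sqrt (L * η)) •
              (U.submatrix id (fun k => (↑(𝒜.orderIsoOfFin h𝒜 k) : Fin m)) * P) ∧
          B = (1 / Real.sqrt (L * η)) •
              (V.submatrix id (fun k => (↑(ℬ.orderIsoOfFin hℬ k) : Fin n)) * Q)) := by
  have hm : 2 * r ≤ m := hrank.trans (by simpa using Matrix.rank_le_card_height G)
  have hn : 2 * r ≤ n := hrank.trans (by simpa using Matrix.rank_le_card_width G)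
  have hc : Real.sqrt (L * η) ≠ 0 := (Real.sqrt_pos.mpr (by positivity)).ne'
  have hanti : ∀ k < 2 * r, ∀ l, k < l → σ l < σ k := fun k hk l hl =>
    (hσmono (k + 1) l hl).trans_lt (hstrict k hk)
  have hpos : ∀ k < 2 * r, 0 < σ k := fun k hk => (hσ0 _).trans_lt (hstrict k hk)
  have hinj : ∀ k < 2 * r, ∀ l < 2 * r, σ k = σ l → k = l := by
    intro k hk l hl h
    rcases lt_trichotomy k l with hkl | hkl | hkl
    · exact absurd h (hanti k hk l hkl).ne'
    · exact hkl
    · exact absurd h (hanti l hl k hkl).ne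
  change G = U * rectDiag m n σ * Vᵀ at hG
  have hEY := fun (X : Matrix (Fin m) (Fin r) ℝ) (Y : Matrix (Fin n) (Fin r) ℝ) =>
    eckart_young hσ0 hσmono hm hn (fun i hi => hanti i hi _ hi) _
      (rank_mul_transpose_mul_add_le (rectDiag m n σ) X Y)
  set τ := fnorm (rectDiag m n σ - initProj m (2 * r) * rectDiag m n σ) ^ 2
  have hselect : ∀ (s : Finset (Fin m)) (t : Finset (Fin n)) (hs : s.card = r) (ht : t.card = r),
      Disjoint (s.image Fin.val) (t.image Fin.val) →
      s.image Fin.val ∪ t.image Fin.val = Finset.range (2 * r) →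
      ∀ P Q : Matrix (Fin r) (Fin r) ℝ, Pᵀ * P = 1 → Qᵀ * Q = 1 →
      objF L η G ((1 / Real.sqrt (L * η)) •
          (U.submatrix id (fun k => (↑(s.orderIsoOfFin hs k) : Fin m)) * P))
        ((1 / Real.sqrt (L * η)) •
          (V.submatrix id (fun k => (↑(t.orderIsoOfFin ht k) : Fin n)) * Q)) =
        1 / (2 * L) * τ := by
    intro s t hs ht hd hu P Q hP hQ
    rw [submatrix_mul_eq U, submatrix_mul_eq V, hG, objF_eq hL hη hU hV,
      selection_mul_transpose s hs P hP, selection_mul_transpose t ht Q hQ,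
      diagonal_mul_rectDiag_add σ s t hd hu]
  constructor
  · intro hmin
    let s₀ : Finset (Fin m) := Finset.univ.filter fun i => (i : ℕ) < r
    let t₀ : Finset (Fin n) := Finset.univ.filter fun j => r ≤ (j : ℕ) ∧ (j : ℕ) < 2 * r
    have hs₀ : s₀.image Fin.val = Finset.range r := by
      ext x
      simp only [s₀, Finset.mem_image, Finset.mem_filter, Finset.mem_univ, true_and,
        Finset.mem_range]
      exact ⟨fun ⟨i, hi, h⟩ => h ▸ hi, fun hx => ⟨⟨x, by omega⟩, hx, rfl⟩⟩
    have ht₀ : t₀.image Fin.val = Finset.Ico r (2 * r) := by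
      ext x
      simp only [t₀, Finset.mem_image, Finset.mem_filter, Finset.mem_univ, true_and,
        Finset.mem_Ico]
      exact ⟨fun ⟨i, hi, h⟩ => h ▸ hi, fun hx => ⟨⟨x, by omega⟩, hx, rfl⟩⟩
    have hs₀c : s₀.card = r := by
      rw [← Finset.card_image_of_injective s₀ Fin.val_injective, hs₀, Finset.card_range]
    have ht₀c : t₀.card = r := by
      rw [← Finset.card_image_of_injective t₀ Fin.val_injective, ht₀, Nat.card_Ico]; omega
    have hle := hmin _ _ |>.trans_eq <| hselect s₀ t₀ hs₀c ht₀c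
      (by rw [hs₀, ht₀, Finset.disjoint_left]; intro x; simp; omega)
      (by rw [hs₀, ht₀]; ext x; simp; omega) 1 1 (by simp) (by simp)
    have hA := smul_orthogonal_mul_cancel hc hU A
    have hB := smul_orthogonal_mul_cancel hc hV B
    set X := Real.sqrt (L * η) • (Uᵀ * A)
    set Y := Real.sqrt (L * η) • (Vᵀ * B)
    rw [← hA, ← hB, hG, objF_eq hL hη hU hV] at hle
    obtain ⟨s, t, hs, ht, hd, hu, hX, hY⟩ := exists_selection_of_eq hm hn hpos hinj X Y
      ((hEY X Y).2 (le_of_mul_le_mul_left hle (by positivity)))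
    obtain ⟨P, hP, hXP⟩ := exists_orthogonal_factor X s hs hX
    obtain ⟨Q, hQ, hYQ⟩ := exists_orthogonal_factor Y t ht hY
    refine ⟨s, t, hs, ht, hd, hu, P, Q, hP, hQ, ?_, ?_⟩
    · rw [submatrix_mul_eq, ← hXP, hA]
    · rw [submatrix_mul_eq, ← hYQ, hB]
  · rintro ⟨s, t, hs, ht, hd, hu, P, Q, hP, hQ, rfl, rfl⟩ A' B'
    rw [hselect s t hs ht hd hu P Q hP hQ, ← smul_orthogonal_mul_cancel hc hU A',
      ← smul_orthogonal_mul_cancel hc hV B', hG, objF_eq hL hη hU hV]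
    exact mul_le_mul_of_nonneg_left (hEY _ _).1 (by positivity)
end

section
/- Let u₁, …, u_{2r} ∈ ℝ^m be orthonormal vectors, v₁, …, v_{2r} ∈ ℝ^n be orthonormal vectors, and σ₁, …, σ_{2r} ≥ 0 be real numbers such that G vᵢ = σᵢ uᵢ and Gᵀ uᵢ = σᵢ vᵢ for each i (i.e., (σᵢ, uᵢ, vᵢ) are singular triples of G ∈ ℝ^{m×n}). Let 𝒜, ℬ ⊆ {1, …, 2r} be disjoint sets with 𝒜 ∪ ℬ = {1, …, 2r} and |𝒜| = |ℬ| = r, let P, Q ∈ O(r), and fix L > 0, η > 0. If A = (1/√(Lη)) U_𝒜 P and B = (1/√(Lη)) V_ℬ Q, where U_𝒜 is the m × r matrix whose columns are the uᵢ with i ∈ 𝒜 and V_ℬ is the n × r matrix whose columns are the vᵢ with i ∈ ℬ, then η G B Bᵀ + η A Aᵀ G = (1/L) Σ_{i=1}^{2r} σᵢ uᵢ vᵢᵀ. -/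
open Matrix

/-- If the columns of `C` are, up to a scalar `c` and a rotation `Q`, the vectors `w i` with
`i ∈ S`, then `C * Cᵀ` is `c ^ 2` times the sum of the rank-one matrices `w i (w i)ᵀ`. -/
theorem smul_mul_orthogonal_mul_transpose_self {ι : Type*} [LinearOrder ι] {d r : ℕ}
    (w : ι → Fin d → ℝ) (S : Finset ι) (hS : S.card = r)
    (Q : Matrix (Fin r) (Fin r) ℝ) (hQ : Qᵀ * Q = 1) (c : ℝ) :
    (c • ((Matrix.of fun (i : Fin d) (k : Fin r) => w (S.orderIsoOfFin hS k) i) * Q)) *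
      (c • ((Matrix.of fun (i : Fin d) (k : Fin r) => w (S.orderIsoOfFin hS k) i) * Q))ᵀ =
      c ^ 2 • ∑ i ∈ S, vecMulVec (w i) (w i) := by
  have hQ' : Q * Qᵀ = 1 := mul_eq_one_comm.mp hQ
  set W : Matrix (Fin d) (Fin r) ℝ := Matrix.of fun i k => w (S.orderIsoOfFin hS k) i with hW
  have hWW : W * Wᵀ = ∑ i ∈ S, vecMulVec (w i) (w i) := by
    rw [← Finset.sum_coe_sort S,
      ← (S.orderIsoOfFin hS).toEquiv.sum_comp (fun i : S => vecMulVec (w i) (w i))]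
    ext a b
    simp [hW, Matrix.mul_apply, Matrix.sum_apply, vecMulVec_apply]
  rw [transpose_smul, transpose_mul, Matrix.smul_mul, Matrix.mul_smul, smul_smul, ← sq,
    Matrix.mul_assoc,
    ← Matrix.mul_assoc Q, hQ', Matrix.one_mul, hWW]

theorem stmt1 {m n r : ℕ} (L η : ℝ) (hL : 0 < L) (hη : 0 < η)
    (G : Matrix (Fin m) (Fin n) ℝ)
    (u : Fin (2 * r) → Fin m → ℝ) (v : Fin (2 * r) → Fin n → ℝ) (σ : Fin (2 * r) → ℝ)
    (hu : ∀ i j, u i ⬝ᵥ u j = if i = j then (1 : ℝ) else 0)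
    (hv : ∀ i j, v i ⬝ᵥ v j = if i = j then (1 : ℝ) else 0)
    (hσ : ∀ i, 0 ≤ σ i)
    (hGv : ∀ i, G.mulVec (v i) = σ i • u i)
    (hGu : ∀ i, Gᵀ.mulVec (u i) = σ i • v i)
    (𝒜 ℬ : Finset (Fin (2 * r))) (h𝒜 : 𝒜.card = r) (hℬ : ℬ.card = r)
    (hdisj : Disjoint 𝒜 ℬ) (hunion : 𝒜 ∪ ℬ = Finset.univ)
    (P Q : Matrix (Fin r) (Fin r) ℝ) (hP : Pᵀ * P = 1) (hQ : Qᵀ * Q = 1)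
    (A : Matrix (Fin m) (Fin r) ℝ) (B : Matrix (Fin n) (Fin r) ℝ)
    (hA : A = (1 / Real.sqrt (L * η)) •
        ((Matrix.of fun (i : Fin m) (k : Fin r) => u (𝒜.orderIsoOfFin h𝒜 k) i) * P))
    (hB : B = (1 / Real.sqrt (L * η)) •
        ((Matrix.of fun (i : Fin n) (k : Fin r) => v (ℬ.orderIsoOfFin hℬ k) i) * Q)) :
    η • (G * B * Bᵀ) + η • (A * Aᵀ * G) =
      (1 / L) • ∑ i : Fin (2 * r), σ i • Matrix.vecMulVec (u i) (v i) := by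
  have hc : (1 / Real.sqrt (L * η)) ^ 2 = 1 / (L * η) := by
    rw [div_pow, one_pow, Real.sq_sqrt (by positivity)]
  have hηc : η * (1 / (L * η)) = 1 / L := by field_simp
  have hB' : G * (B * Bᵀ) = (1 / (L * η)) • ∑ i ∈ ℬ, σ i • vecMulVec (u i) (v i) := by
    rw [hB, smul_mul_orthogonal_mul_transpose_self v ℬ hℬ Q hQ, hc, Matrix.mul_smul, Matrix.mul_sum]
    simp only [mul_vecMulVec, hGv, smul_vecMulVec]
  have hA' : A * Aᵀ * G = (1 / (L * η)) • ∑ i ∈ 𝒜, σ i • vecMulVec (u i) (v i) := by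
    rw [hA, smul_mul_orthogonal_mul_transpose_self u 𝒜 h𝒜 P hP, hc, Matrix.smul_mul, Matrix.sum_mul]
    simp only [vecMulVec_mul, ← mulVec_transpose, hGu, vecMulVec_smul]
  rw [Matrix.mul_assoc, hB', hA', smul_smul, smul_smul, hηc, ← smul_add, add_comm,
    ← Finset.sum_union hdisj, hunion]
end

section
/- Assume A, B are not both such that Aᵀ G = 0 and G B = 0. If C^A > 0 and C^B ≤ 0, then the pair (α*, β*) with α* = ± ‖Aᵀ G‖_F / (√(Lη) ‖A Aᵀ G‖_F) and β* = 0 is a global minimizer of f over ℝ². -/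
open Matrix

/-- The scalar-scaling objective f(α, β) := (L/2) ‖ (1/L) G − η β² G B Bᵀ − η α² A Aᵀ G ‖_F². -/
noncomputable def scalObj {m n r : ℕ} (L η : ℝ) (G : Matrix (Fin m) (Fin n) ℝ)
    (A : Matrix (Fin m) (Fin r) ℝ) (B : Matrix (Fin n) (Fin r) ℝ) (α β : ℝ) : ℝ :=
  (L / 2) *
    (fnorm ((1 / L) • G - (η * β ^ 2) • (G * B * Bᵀ) - (η * α ^ 2) • (A * Aᵀ * G))) ^ 2

/-- C^A := ‖Aᵀ G‖_F² ‖G B Bᵀ‖_F² − ‖G B‖_F² ‖Aᵀ G B‖_F². -/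
noncomputable def CA {m n r : ℕ} (G : Matrix (Fin m) (Fin n) ℝ)
    (A : Matrix (Fin m) (Fin r) ℝ) (B : Matrix (Fin n) (Fin r) ℝ) : ℝ :=
  (fnorm (Aᵀ * G)) ^ 2 * (fnorm (G * B * Bᵀ)) ^ 2 -
    (fnorm (G * B)) ^ 2 * (fnorm (Aᵀ * G * B)) ^ 2

/-- C^B := ‖G B‖_F² ‖A Aᵀ G‖_F² − ‖Aᵀ G‖_F² ‖Aᵀ G B‖_F². -/
noncomputable def CB {m n r : ℕ} (G : Matrix (Fin m) (Fin n) ℝ)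
    (A : Matrix (Fin m) (Fin r) ℝ) (B : Matrix (Fin n) (Fin r) ℝ) : ℝ :=
  (fnorm (G * B)) ^ 2 * (fnorm (A * Aᵀ * G)) ^ 2 -
    (fnorm (Aᵀ * G)) ^ 2 * (fnorm (Aᵀ * G * B)) ^ 2

/-- First-order lower bound for the squared Frobenius norm. -/
theorem fnorm_sq_le_of_trace_le {m n : ℕ} (R D : Matrix (Fin m) (Fin n) ℝ)
    (h : (Rᵀ * D).trace ≤ 0) : fnorm R ^ 2 ≤ fnorm (R - D) ^ 2 := by
  have hD := sq_nonneg (fnorm D)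
  have hc : (Dᵀ * R).trace = (Rᵀ * D).trace := by
    rw [← trace_transpose, transpose_mul, transpose_transpose]
  rw [fnorm_sq_eq_trace] at *
  rw [fnorm_sq_eq_trace]
  simp only [transpose_sub, Matrix.sub_mul, Matrix.mul_sub, trace_sub, hc]
  linarith

theorem trace_transpose_mul_gram_left {m n r : ℕ} (G : Matrix (Fin m) (Fin n) ℝ)
    (A : Matrix (Fin m) (Fin r) ℝ) : (Gᵀ * (A * Aᵀ * G)).trace = fnorm (Aᵀ * G) ^ 2 := by
  rw [fnorm_sq_eq_trace]
  simp only [transpose_mul, transpose_transpose, Matrix.mul_assoc]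

theorem trace_transpose_mul_gram_right {m n r : ℕ} (G : Matrix (Fin m) (Fin n) ℝ)
    (B : Matrix (Fin n) (Fin r) ℝ) : (Gᵀ * (G * B * Bᵀ)).trace = fnorm (G * B) ^ 2 := by
  rw [fnorm_sq_eq_trace, ← Matrix.mul_assoc, trace_mul_comm]
  simp only [transpose_mul, Matrix.mul_assoc]

theorem trace_gram_left_transpose_mul_gram_right {m n r : ℕ} (G : Matrix (Fin m) (Fin n) ℝ)
    (A : Matrix (Fin m) (Fin r) ℝ) (B : Matrix (Fin n) (Fin r) ℝ) :
    ((A * Aᵀ * G)ᵀ * (G * B * Bᵀ)).trace = fnorm (Aᵀ * G * B) ^ 2 := by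
  rw [fnorm_sq_eq_trace, ← Matrix.mul_assoc, trace_mul_comm]
  simp only [transpose_mul, transpose_transpose, Matrix.mul_assoc]

theorem stmt2 {m n r : ℕ} (hm : 0 < m) (hn : 0 < n) (hr : 0 < r)
    (L η : ℝ) (hL : 0 < L) (hη : 0 < η)
    (G : Matrix (Fin m) (Fin n) ℝ)
    (A : Matrix (Fin m) (Fin r) ℝ) (B : Matrix (Fin n) (Fin r) ℝ)
    (hnz : ¬(Aᵀ * G = 0 ∧ G * B = 0))
    (hCA : 0 < CA G A B) (hCB : CB G A B ≤ 0) :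
    ∀ αs : ℝ,
      (αs = fnorm (Aᵀ * G) / (Real.sqrt (L * η) * fnorm (A * Aᵀ * G)) ∨
       αs = -(fnorm (Aᵀ * G) / (Real.sqrt (L * η) * fnorm (A * Aᵀ * G)))) →
      ∀ α β : ℝ, scalObj L η G A B αs 0 ≤ scalObj L η G A B α β := by
  intro αs hαs α β
  have ha : 0 < fnorm (Aᵀ * G) ^ 2 := by
    refine (sq_nonneg _).lt_of_ne' fun h0 => hCA.not_ge ?_
    rw [CA, h0]
    nlinarith [mul_nonneg (sq_nonneg (fnorm (G * B))) (sq_nonneg (fnorm (Aᵀ * G * B)))]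
  have hp : 0 < fnorm (A * Aᵀ * G) ^ 2 := by
    refine (sq_nonneg _).lt_of_ne' fun h0 => ha.ne' ?_
    rw [fnorm_sq_eq_trace, ← conjTranspose_eq_transpose_of_trivial (A * Aᵀ * G),
      trace_conjTranspose_mul_self_eq_zero_iff] at h0
    rw [← trace_transpose_mul_gram_left, h0, Matrix.mul_zero, trace_zero]
  have hx : αs ^ 2 = fnorm (Aᵀ * G) ^ 2 / (L * η * fnorm (A * Aᵀ * G) ^ 2) := by
    rcases hαs with rfl | rfl <;>
      simp only [neg_sq, div_pow, mul_pow, Real.sq_sqrt (mul_pos hL hη).le]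
  have hPP := (fnorm_sq_eq_trace (A * Aᵀ * G)).symm
  have hGP := trace_transpose_mul_gram_left G A
  have hGN := trace_transpose_mul_gram_right G B
  have hPN := trace_gram_left_transpose_mul_gram_right G A B
  unfold CB at hCB
  unfold scalObj
  generalize A * Aᵀ * G = P at *
  generalize G * B * Bᵀ = N at *
  refine mul_le_mul_of_nonneg_left ?_ (by positivity)
  have hD : (1 / L) • G - (η * β ^ 2) • N - (η * α ^ 2) • P =
      ((1 / L) • G - (η * αs ^ 2) • P) -
        ((η * β ^ 2) • N + (η * (α ^ 2 - αs ^ 2)) • P) := by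
    module
  have hR : (1 / L) • G - (η * 0 ^ 2) • N - (η * αs ^ 2) • P =
      (1 / L) • G - (η * αs ^ 2) • P := by
    module
  rw [hD, hR]
  apply fnorm_sq_le_of_trace_le
  simp only [transpose_sub, transpose_smul, Matrix.sub_mul, Matrix.mul_add, Matrix.smul_mul,
    Matrix.mul_smul, trace_sub, trace_add, trace_smul, smul_eq_mul, hPP, hGP, hGN, hPN, hx]
  generalize fnorm (Aᵀ * G) ^ 2 = a at *
  generalize fnorm (G * B) ^ 2 = b at *
  generalize fnorm (Aᵀ * G * B) ^ 2 = c at *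
  generalize fnorm P ^ 2 = p at *
  calc _ = η * β ^ 2 * (b * p - a * c) / (L * p) := by field_simp; ring
    _ ≤ 0 := div_nonpos_of_nonpos_of_nonneg
      (mul_nonpos_of_nonneg_of_nonpos (by positivity) hCB) (by positivity)
end

section
/- Assume Aᵀ G ≠ 0. Then there exists α > 0 such that f(α, 0) < f(0, 0) = (1/(2L)) ‖G‖_F²; in particular, (0, 0) is not a global minimizer of f over ℝ². -/
open Matrix

theorem fnorm_sq_pos {m n : ℕ} {M : Matrix (Fin m) (Fin n) ℝ} (hM : M ≠ 0) :
    0 < fnorm M ^ 2 := by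
  refine lt_of_le_of_ne (sq_nonneg _) fun h => hM ?_
  rw [fnorm_sq_eq_trace, ← Matrix.conjTranspose_eq_transpose_of_trivial] at h
  exact Matrix.trace_conjTranspose_mul_self_eq_zero_iff.mp h.symm

theorem fnorm_smul_sub_sq {m n r : ℕ} (c t : ℝ) (G : Matrix (Fin m) (Fin n) ℝ)
    (A : Matrix (Fin m) (Fin r) ℝ) :
    fnorm (c • G - t • (A * Aᵀ * G)) ^ 2 =
      c ^ 2 * fnorm G ^ 2 - 2 * c * t * fnorm (Aᵀ * G) ^ 2 +
        t ^ 2 * fnorm (A * Aᵀ * G) ^ 2 := by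
  simp only [fnorm_sq_eq_trace, Matrix.transpose_sub, Matrix.transpose_smul,
    Matrix.transpose_mul, Matrix.transpose_transpose, Matrix.sub_mul, Matrix.mul_sub,
    Matrix.smul_mul, Matrix.mul_smul, Matrix.trace_sub, Matrix.trace_smul, Matrix.mul_assoc,
    smul_eq_mul]
  ring

theorem scalObj_right_zero {m n r : ℕ} (L η : ℝ) (G : Matrix (Fin m) (Fin n) ℝ)
    (A : Matrix (Fin m) (Fin r) ℝ) (B : Matrix (Fin n) (Fin r) ℝ) (α : ℝ) :
    scalObj L η G A B α 0 = L / 2 * ((1 / L) ^ 2 * fnorm G ^ 2 -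
      2 * (1 / L) * (η * α ^ 2) * fnorm (Aᵀ * G) ^ 2 +
        (η * α ^ 2) ^ 2 * fnorm (A * Aᵀ * G) ^ 2) := by
  rw [← fnorm_smul_sub_sq]
  simp [scalObj]

theorem exists_pos_scalObj_lt {m n r : ℕ} {L η : ℝ} (hL : 0 < L) (hη : 0 < η)
    {G : Matrix (Fin m) (Fin n) ℝ} {A : Matrix (Fin m) (Fin r) ℝ}
    (B : Matrix (Fin n) (Fin r) ℝ) (hAG : Aᵀ * G ≠ 0) :
    ∃ α : ℝ, 0 < α ∧ scalObj L η G A B α 0 < scalObj L η G A B 0 0 := by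
  have hP := fnorm_sq_pos hAG
  have hQ := sq_nonneg (fnorm (A * Aᵀ * G))
  simp only [scalObj_right_zero]
  set P := fnorm (Aᵀ * G) ^ 2
  set Q := fnorm (A * Aᵀ * G) ^ 2
  have hc : 0 < 1 / L := by positivity
  set c := 1 / L
  set t := c * P / (Q + 1) with ht
  have htpos : 0 < t := by positivity
  have htQ : t * (Q + 1) = c * P := by rw [ht]; field_simp
  have hα : η * √(t / η) ^ 2 = t := by
    rw [Real.sq_sqrt (by positivity)]; field_simp
  refine ⟨√(t / η), by positivity, mul_lt_mul_of_pos_left ?_ (by positivity)⟩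
  rw [hα]
  have hdecrease : t * (t * Q - 2 * (c * P)) < 0 :=
    mul_neg_of_pos_of_neg htpos (by nlinarith [mul_pos hc hP])
  linarith

theorem stmt9 {m n r : ℕ} (hm : 0 < m) (hn : 0 < n) (hr : 0 < r)
    (L η : ℝ) (hL : 0 < L) (hη : 0 < η)
    (G : Matrix (Fin m) (Fin n) ℝ)
    (A : Matrix (Fin m) (Fin r) ℝ) (B : Matrix (Fin n) (Fin r) ℝ)
    (hAG : Aᵀ * G ≠ 0) :
    (∃ α : ℝ, 0 < α ∧ scalObj L η G A B α 0 < scalObj L η G A B 0 0) ∧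
    scalObj L η G A B 0 0 = (1 / (2 * L)) * (fnorm G) ^ 2 ∧
    ¬(∀ α β : ℝ, scalObj L η G A B 0 0 ≤ scalObj L η G A B α β) := by
  have hlt := exists_pos_scalObj_lt hL hη B hAG
  refine ⟨hlt, ?_, fun hmin => ?_⟩
  · rw [scalObj_right_zero]
    field_simp
    ring
  · obtain ⟨α, -, hα⟩ := hlt
    exact (hmin α 0).not_gt hα
end

section
/- Assume A Aᵀ G ≠ 0 and fix β ∈ ℝ. Then the function g(s) := (L/2) ‖ (1/L) G − η β² G B Bᵀ − η s A Aᵀ G ‖_F², restricted to s ≥ 0, attains its minimum at s* = max{ 0, ( ‖Aᵀ G‖_F² / (Lη) − β² ‖Aᵀ G B‖_F² ) / ‖A Aᵀ G‖_F² }. -/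
open Matrix

/-- g(s) := (L/2) ‖ (1/L) G − η β² G B Bᵀ − η s A Aᵀ G ‖_F². -/
noncomputable def gObj {m n r : ℕ} (L η β : ℝ) (G : Matrix (Fin m) (Fin n) ℝ)
    (A : Matrix (Fin m) (Fin r) ℝ) (B : Matrix (Fin n) (Fin r) ℝ) (s : ℝ) : ℝ :=
  (L / 2) *
    (fnorm ((1 / L) • G - (η * β ^ 2) • (G * B * Bᵀ) - (η * s) • (A * Aᵀ * G))) ^ 2

theorem fnorm_sub_smul_sq {m n : ℕ} (H C : Matrix (Fin m) (Fin n) ℝ) (c : ℝ) :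
    fnorm (H - c • C) ^ 2 = fnorm H ^ 2 - 2 * c * (Hᵀ * C).trace + c ^ 2 * fnorm C ^ 2 := by
  have hsymm : (Cᵀ * H).trace = (Hᵀ * C).trace := by
    rw [← Matrix.trace_transpose, Matrix.transpose_mul, Matrix.transpose_transpose]
  simp only [fnorm_sq_eq_trace, Matrix.transpose_sub, Matrix.transpose_smul, Matrix.sub_mul,
    Matrix.mul_sub, Matrix.smul_mul, Matrix.mul_smul, Matrix.trace_sub, Matrix.trace_smul,
    smul_eq_mul, hsymm]
  ring

theorem trace_transpose_mul_gram {m n r : ℕ} (L η β : ℝ) (G : Matrix (Fin m) (Fin n) ℝ)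
    (A : Matrix (Fin m) (Fin r) ℝ) (B : Matrix (Fin n) (Fin r) ℝ) :
    (((1 / L) • G - (η * β ^ 2) • (G * B * Bᵀ))ᵀ * (A * Aᵀ * G)).trace =
      fnorm (Aᵀ * G) ^ 2 / L - η * β ^ 2 * fnorm (Aᵀ * G * B) ^ 2 := by
  have hcycle : (B * (Bᵀ * (Gᵀ * (A * (Aᵀ * G))))).trace =
      (Bᵀ * (Gᵀ * (A * (Aᵀ * (G * B))))).trace := by
    rw [Matrix.trace_mul_comm]
    simp only [Matrix.mul_assoc]
  simp only [fnorm_sq_eq_trace, Matrix.transpose_sub, Matrix.transpose_smul, Matrix.sub_mul,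
    Matrix.smul_mul, Matrix.trace_sub, Matrix.trace_smul, smul_eq_mul, Matrix.transpose_mul,
    Matrix.transpose_transpose, Matrix.mul_assoc, hcycle]
  ring

theorem max_zero_sq_sub_le {s : ℝ} (hs : 0 ≤ s) (t : ℝ) :
    max 0 t ^ 2 - 2 * max 0 t * t ≤ s ^ 2 - 2 * s * t := by
  rcases le_total t 0 with ht | ht
  · rw [max_eq_left ht]
    nlinarith [mul_nonneg hs (neg_nonneg.2 ht), sq_nonneg s]
  · rw [max_eq_right ht]
    nlinarith [sq_nonneg (s - t)]

theorem stmt10 {m n r : ℕ} (hm : 0 < m) (hn : 0 < n) (hr : 0 < r)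
    (L η : ℝ) (hL : 0 < L) (hη : 0 < η)
    (G : Matrix (Fin m) (Fin n) ℝ)
    (A : Matrix (Fin m) (Fin r) ℝ) (B : Matrix (Fin n) (Fin r) ℝ)
    (hAAG : A * Aᵀ * G ≠ 0) (β : ℝ) :
    0 ≤ max 0 (((fnorm (Aᵀ * G)) ^ 2 / (L * η) - β ^ 2 * (fnorm (Aᵀ * G * B)) ^ 2) /
        (fnorm (A * Aᵀ * G)) ^ 2) ∧
    ∀ s : ℝ, 0 ≤ s →
      gObj L η β G A B
        (max 0 (((fnorm (Aᵀ * G)) ^ 2 / (L * η) - β ^ 2 * (fnorm (Aᵀ * G * B)) ^ 2) /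
          (fnorm (A * Aᵀ * G)) ^ 2)) ≤ gObj L η β G A B s := by
  refine ⟨le_max_left _ _, fun s hs => ?_⟩
  have hK := fnorm_sq_pos hAAG
  set t := ((fnorm (Aᵀ * G)) ^ 2 / (L * η) - β ^ 2 * (fnorm (Aᵀ * G * B)) ^ 2) /
    (fnorm (A * Aᵀ * G)) ^ 2 with ht
  have hinner : fnorm (Aᵀ * G) ^ 2 / L - η * β ^ 2 * fnorm (Aᵀ * G * B) ^ 2 =
      η * fnorm (A * Aᵀ * G) ^ 2 * t := by
    have hne : fnorm (A * Aᵀ * G) ≠ 0 := pow_ne_zero_iff two_ne_zero |>.1 hK.ne'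
    rw [ht]
    field_simp
  simp only [gObj, fnorm_sub_smul_sq _ (A * Aᵀ * G), trace_transpose_mul_gram, hinner]
  refine mul_le_mul_of_nonneg_left ?_ (by positivity)
  have hquad := mul_le_mul_of_nonneg_left (max_zero_sq_sub_le hs t)
    (by positivity : 0 ≤ η ^ 2 * fnorm (A * Aᵀ * G) ^ 2)
  linarith
end

section
/- Let Σ ∈ ℝ^{k×k} be a diagonal matrix with diagonal entries σ₁, …, σ_k satisfying σᵢ² ≠ σⱼ² for all i ≠ j, let c ∈ ℝ, and let D_A, D_B ∈ ℝ^{k×k} be symmetric matrices satisfying Σ D_B + D_A Σ = c Σ. Then D_A and D_B are both diagonal matrices. -/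
open Matrix

theorem stmt14 {k : ℕ} (σ : Fin k → ℝ)
    (hσ : ∀ i j, i ≠ j → σ i ^ 2 ≠ σ j ^ 2) (c : ℝ)
    (DA DB : Matrix (Fin k) (Fin k) ℝ) (hDA : DAᵀ = DA) (hDB : DBᵀ = DB)
    (h : Matrix.diagonal σ * DB + DA * Matrix.diagonal σ = c • Matrix.diagonal σ) :
    DA.IsDiag ∧ DB.IsDiag := by
  have entry : ∀ i j, i ≠ j → σ i * DB i j + DA i j * σ j = 0 := by
    intro i j hij
    have hentry := congrFun (congrFun h i) j
    simpa [Matrix.diagonal_apply_ne σ hij] using hentry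
  have entry_symm : ∀ i j, i ≠ j → σ j * DB i j + DA i j * σ i = 0 := by
    intro i j hij
    have hentry := entry j i hij.symm
    rwa [← Matrix.transpose_apply DB, ← Matrix.transpose_apply DA, hDA, hDB] at hentry
  constructor <;> intro i j hij <;>
    refine (mul_eq_zero.mp ?_).resolve_left (sub_ne_zero.mpr (hσ i j hij))
  · linear_combination σ i * entry_symm i j hij - σ j * entry i j hij
  · linear_combination σ i * entry i j hij - σ j * entry_symm i j hij
end
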